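/- arXiv:2101.00104 — 2 statements merged into one kernel-verified Lean document; each statement's English description precedes it below -/
import Mathlib

section
/- Let a > 0 and α ∈ ℝ, and let f : (0,a] → (0,∞) be nondecreasing and right-continuous, with μ_f its Lebesgue–Stieltjes measure on (0,a]. For γ ∈ ℝ \ {0} consider the three conditions: (A.7) ∫_{(0,a]} s^γ dμ_f(s) < ∞; (A.8) lim_{v↓0} v^γ f(v) = 0; and (A.9) lim_{v↓0} (1/(v^γ f(v))) ∫_{(0,v]} s^γ dμ_f(s) = α/(γ+α). Then the following are equivalent: (i) f is regularly varying at 0₊ with index α; (ii) for every γ ∈ ℝ \ {0} with γ + α > 0, conditions (A.7), (A.8) and (A.9) hold; (iii) there exists γ ∈ ℝ \ {0} with γ + α > 0 such that conditions (A.7), (A.8) and (A.9) hold. -/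
open Filter MeasureTheory

/-- A function `f : (0,a] → (0,∞)` is regularly varying at `0₊` with index `α` if
`f(λx)/f(x) → λ^α` as `x ↓ 0`, for every `λ > 0`. -/
def RegularlyVaryingAtZero (f : ℝ → ℝ) (α : ℝ) : Prop :=
  ∀ l : ℝ, 0 < l →
    Tendsto (fun x => f (l * x) / f x) (nhdsWithin 0 (Set.Ioi 0)) (nhds (l ^ α))

section
open Set Topology

/-- The sets `Ioc x v` exhaust `Ioc 0 v` as `x ↓ 0`, for any measure. -/
theorem aecover_Ioc_nhdsGT_zero (ν : Measure ℝ) (v : ℝ) :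
    AECover (ν.restrict (Ioc 0 v)) (𝓝[>] 0) fun x => Ioc x v where
  ae_eventually_mem := (ae_restrict_mem measurableSet_Ioc).mono fun s hs => by
    filter_upwards [Ioo_mem_nhdsGT hs.1] with x hx using ⟨hx.2, hs.2⟩
  measurableSet _ := measurableSet_Ioc

theorem tendsto_setIntegral_Ioc_nhdsGT_zero {ν : Measure ℝ} {g : ℝ → ℝ} {v : ℝ}
    (hg : IntegrableOn g (Ioc 0 v) ν) :
    Tendsto (fun x => ∫ s in Ioc x v, g s ∂ν) (𝓝[>] 0) (𝓝 (∫ s in Ioc 0 v, g s ∂ν)) := by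
  refine ((aecover_Ioc_nhdsGT_zero ν v).integral_tendsto_of_countably_generated hg).congr' ?_
  filter_upwards [self_mem_nhdsWithin] with x hx
  rw [Measure.restrict_restrict measurableSet_Ioc,
    inter_eq_self_of_subset_left (Ioc_subset_Ioc_left (le_of_lt hx))]

theorem integrableOn_Ioc_zero_of_tendsto {ν : Measure ℝ} {g : ℝ → ℝ} {v l : ℝ}
    (hg : ∀ s ∈ Ioc 0 v, 0 ≤ g s) (hint : ∀ x, 0 < x → IntegrableOn g (Ioc x v) ν)
    (hl : Tendsto (fun x => ∫ s in Ioc x v, g s ∂ν) (𝓝[>] 0) (𝓝 l)) :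
    IntegrableOn g (Ioc 0 v) ν := by
  have hr : ∀ x : ℝ, 0 < x →
      (ν.restrict (Ioc 0 v)).restrict (Ioc x v) = ν.restrict (Ioc x v) := fun x hx => by
    rw [Measure.restrict_restrict measurableSet_Ioc,
      inter_eq_self_of_subset_left (Ioc_subset_Ioc_left hx.le)]
  -- replace the filter by a sequence so that integrability holds for every index
  have hu : Tendsto (fun n : ℕ => 1 / ((n : ℝ) + 1)) atTop (𝓝[>] 0) :=
    tendsto_nhdsWithin_iff.2 ⟨tendsto_one_div_add_atTop_nhds_zero_nat,
      Eventually.of_forall fun n => by simp only [mem_Ioi]; positivity⟩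
  have hc := (aecover_Ioc_nhdsGT_zero ν v).comp_tendsto hu
  have hp : ∀ n : ℕ, 0 < 1 / ((n : ℝ) + 1) := fun n => by positivity
  refine hc.integrable_of_integral_tendsto_of_nonneg_ae l (fun n => ?_)
    ((ae_restrict_mem measurableSet_Ioc).mono hg) ((hl.comp hu).congr fun n => ?_)
  · simpa only [IntegrableOn, Function.comp, hr _ (hp n)] using hint _ (hp n)
  · simp only [Function.comp, hr _ (hp n)]

theorem exists_norm_rpow_le {x : ℝ} (hx : 0 < x) (v r : ℝ) :
    ∃ C, ∀ s ∈ Icc x v, ‖s ^ r‖ ≤ C :=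
  isCompact_Icc.exists_bound_of_continuousOn
    (continuousOn_id.rpow_const fun _ hs => Or.inl (hx.trans_le hs.1).ne')

theorem integrableOn_rpow_Ioc {ν : Measure ℝ} {x v : ℝ} (r : ℝ) (hx : 0 < x)
    (hν : ν (Ioc x v) ≠ ⊤) : IntegrableOn (fun s => s ^ r) (Ioc x v) ν := by
  obtain ⟨C, hC⟩ := exists_norm_rpow_le hx v r
  exact Measure.integrableOn_of_bounded hν (by fun_prop)
    ((ae_restrict_mem measurableSet_Ioc).mono fun s hs => hC s (Ioc_subset_Icc_self hs))

theorem integrableOn_rpow_mul_Ioc {f : ℝ → ℝ} {x v : ℝ} (r : ℝ) (hx : 0 < x)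
    (hf : MonotoneOn f (Ioc 0 v)) :
    IntegrableOn (fun s => s ^ r * f s) (Ioc x v) := by
  obtain ⟨C, hC⟩ := exists_norm_rpow_le hx v r
  rcases le_or_gt v x with hvx | hxv
  · simp [Ioc_eq_empty hvx.not_gt]
  have hfi : IntegrableOn f (Icc x v) :=
    (hf.mono fun s hs => ⟨hx.trans_le hs.1, hs.2⟩).integrableOn_isCompact isCompact_Icc
  exact (hfi.mono_set Ioc_subset_Icc_self).bdd_mul (c := C) (by fun_prop)
    ((ae_restrict_mem measurableSet_Ioc).mono fun s hs => hC s (Ioc_subset_Icc_self hs))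

/-- Integration by parts for `s ^ γ` against the Stieltjes measure of `f`. -/
theorem setIntegral_rpow_stieltjes {f : ℝ → ℝ} {μ : Measure ℝ} {x v γ : ℝ}
    (hx : 0 < x) (hxv : x ≤ v) (hγ : γ ≠ 0) (hf : MonotoneOn f (Ioc 0 v))
    (hμ : ∀ y ∈ Icc x v, μ (Ioc x y) = ENNReal.ofReal (f y - f x)) :
    ∫ s in Ioc x v, s ^ γ ∂μ =
      v ^ γ * f v - x ^ γ * f x - γ * ∫ s in Ioc x v, s ^ (γ - 1) * f s := by
  have hfx : ∀ y ∈ Icc x v, 0 ≤ f y - f x := fun y hy =>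
    sub_nonneg.2 (hf ⟨hx, hxv⟩ ⟨hx.trans_le hy.1, hy.2⟩ hy.1)
  have hreal : ∀ y ∈ Icc x v, μ.real (Ioc x y) = f y - f x := fun y hy => by
    rw [Measure.real, hμ y hy, ENNReal.toReal_ofReal (hfx y hy)]
  have hfin : μ (Ioc x v) ≠ ⊤ := by rw [hμ v ⟨hxv, le_rfl⟩]; exact ENNReal.ofReal_ne_top
  have : IsFiniteMeasure (μ.restrict (Ioc x v)) := ⟨by simpa using hfin.lt_top⟩
  have hrpow : ∀ s ∈ Icc x v, ∫ u in s..v, u ^ (γ - 1) = (v ^ γ - s ^ γ) / γ := fun s hs => by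
    rw [integral_rpow (Or.inr ⟨by simpa [sub_eq_iff_eq_add] using hγ, fun h => ?_⟩), sub_add_cancel]
    rw [uIcc_of_le hs.2] at h
    exact absurd h.1 (hx.trans_le hs.1).not_ge
  obtain ⟨C, hC⟩ := exists_norm_rpow_le hx v (γ - 1)
  have hprod : Integrable
      (Function.uncurry fun s u : ℝ => (Ici s).indicator (fun u => u ^ (γ - 1)) u)
      ((μ.restrict (Ioc x v)).prod (volume.restrict (Ioc x v))) := by
    have hm : Measurable
        (Function.uncurry fun s u : ℝ => (Ici s).indicator (fun u => u ^ (γ - 1)) u) := by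
      have : (Function.uncurry fun s u : ℝ => (Ici s).indicator (fun u => u ^ (γ - 1)) u) =
          {p : ℝ × ℝ | p.1 ≤ p.2}.indicator fun p => p.2 ^ (γ - 1) := by
        ext ⟨s, u⟩
        simp [indicator_apply]
      rw [this]
      exact Measurable.indicator (by fun_prop) (measurableSet_le measurable_fst measurable_snd)
    refine Integrable.of_bound hm.aestronglyMeasurable C ?_
    have h2 := (Measure.quasiMeasurePreserving_snd (μ := μ.restrict (Ioc x v))
      (ν := (volume : Measure ℝ).restrict (Ioc x v))).ae
        (ae_restrict_mem (μ := (volume : Measure ℝ)) (measurableSet_Ioc (a := x) (b := v)))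
    filter_upwards [h2] with p hp
    exact (norm_indicator_le_norm_self (fun u : ℝ => u ^ (γ - 1)) p.2).trans
      (hC _ (Ioc_subset_Icc_self hp))
  have hswap := integral_integral_swap hprod
  have hL : ∫ s in Ioc x v, (∫ u in Ioc x v, (Ici s).indicator (fun u => u ^ (γ - 1)) u) ∂μ =
      (v ^ γ * (f v - f x) - ∫ s in Ioc x v, s ^ γ ∂μ) / γ := by
    have : ∫ s in Ioc x v, (∫ u in Ioc x v, (Ici s).indicator (fun u => u ^ (γ - 1)) u) ∂μ =
        ∫ s in Ioc x v, (v ^ γ - s ^ γ) / γ ∂μ := by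
      refine setIntegral_congr_fun measurableSet_Ioc fun s hs => ?_
      have hset : Ioc x v ∩ Ici s = Icc s v := by
        ext u
        simp only [mem_inter_iff, mem_Ioc, mem_Ici, mem_Icc]
        exact ⟨fun h => ⟨h.2, h.1.2⟩, fun h => ⟨⟨hs.1.trans_le h.1, h.2⟩, h.1⟩⟩
      rw [setIntegral_indicator measurableSet_Ici, hset, integral_Icc_eq_integral_Ioc,
        ← intervalIntegral.integral_of_le hs.2, hrpow s (Ioc_subset_Icc_self hs)]
    rw [this, integral_div, integral_sub (integrable_const _) (integrableOn_rpow_Ioc γ hx hfin),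
      setIntegral_const, hreal v ⟨hxv, le_rfl⟩, smul_eq_mul, mul_comm]
  have hR : ∫ u in Ioc x v, ∫ s in Ioc x v, (Ici s).indicator (fun u => u ^ (γ - 1)) u ∂μ =
      (∫ u in Ioc x v, u ^ (γ - 1) * f u) - (v ^ γ - x ^ γ) / γ * f x := by
    have : ∫ u in Ioc x v, ∫ s in Ioc x v, (Ici s).indicator (fun u => u ^ (γ - 1)) u ∂μ =
        ∫ u in Ioc x v, (u ^ (γ - 1) * f u - u ^ (γ - 1) * f x) := by
      refine setIntegral_congr_fun measurableSet_Ioc fun u hu => ?_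
      have hind : ∀ s, (Ici s).indicator (fun u => u ^ (γ - 1)) u =
          (Iic u).indicator (fun _ => u ^ (γ - 1)) s := fun s => by
        simp [indicator_apply]
      simp only [hind]
      rw [setIntegral_indicator measurableSet_Iic, Ioc_inter_Iic, min_eq_right hu.2,
        setIntegral_const, hreal u (Ioc_subset_Icc_self hu), smul_eq_mul]
      ring
    rw [this, integral_sub (integrableOn_rpow_mul_Ioc _ hx hf)
      ((integrableOn_rpow_Ioc _ hx (by simp)).mul_const _), integral_mul_const,
      ← intervalIntegral.integral_of_le hxv, ← intervalIntegral.integral_of_le hxv,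
      hrpow x ⟨le_rfl, hxv⟩]
  rw [hL, hR] at hswap
  field_simp at hswap
  linarith

/-- If `v ^ γ * f v → 0`, integration by parts holds up to the origin. -/
theorem integrableOn_rpow_stieltjes_iff {f : ℝ → ℝ} {μ : Measure ℝ} {v γ : ℝ}
    (hv : 0 < v) (hγ : γ ≠ 0) (hf : MonotoneOn f (Ioc 0 v)) (hpos : ∀ x ∈ Ioc 0 v, 0 < f x)
    (hμ : ∀ x y, 0 < x → x ≤ y → y ≤ v → μ (Ioc x y) = ENNReal.ofReal (f y - f x))
    (h0 : Tendsto (fun x => x ^ γ * f x) (𝓝[>] 0) (𝓝 0)) :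
    (IntegrableOn (fun s => s ^ γ) (Ioc 0 v) μ ↔
      IntegrableOn (fun s => s ^ (γ - 1) * f s) (Ioc 0 v)) ∧
    (IntegrableOn (fun s => s ^ (γ - 1) * f s) (Ioc 0 v) →
      ∫ s in Ioc 0 v, s ^ γ ∂μ = v ^ γ * f v - γ * ∫ s in Ioc 0 v, s ^ (γ - 1) * f s) := by
  have hparts : ∀ᶠ x in 𝓝[>] (0 : ℝ), ∫ s in Ioc x v, s ^ γ ∂μ =
      v ^ γ * f v - x ^ γ * f x - γ * ∫ s in Ioc x v, s ^ (γ - 1) * f s := by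
    filter_upwards [Ioo_mem_nhdsGT hv] with x hx
    exact setIntegral_rpow_stieltjes hx.1 hx.2.le hγ hf fun y hy => hμ x y hx.1 hy.1 hy.2
  have hint : ∀ x, 0 < x → IntegrableOn (fun s => s ^ γ) (Ioc x v) μ := fun x hx => by
    rcases le_or_gt v x with h | h
    · simp [Ioc_eq_empty h.not_gt]
    · exact integrableOn_rpow_Ioc γ hx (by rw [hμ x v hx h.le le_rfl]; exact ENNReal.ofReal_ne_top)
  have hlim : IntegrableOn (fun s => s ^ (γ - 1) * f s) (Ioc 0 v) →
      Tendsto (fun x => ∫ s in Ioc x v, s ^ γ ∂μ) (𝓝[>] 0)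
        (𝓝 (v ^ γ * f v - γ * ∫ s in Ioc 0 v, s ^ (γ - 1) * f s)) := fun h => by
    have := ((tendsto_const_nhds (x := v ^ γ * f v)).sub h0).sub
      ((tendsto_setIntegral_Ioc_nhdsGT_zero h).const_mul γ)
    rw [sub_zero] at this
    exact this.congr' (hparts.mono fun x hx => hx.symm)
  have hback : IntegrableOn (fun s => s ^ (γ - 1) * f s) (Ioc 0 v) →
      IntegrableOn (fun s => s ^ γ) (Ioc 0 v) μ := fun h =>
    integrableOn_Ioc_zero_of_tendsto (fun s hs => Real.rpow_nonneg hs.1.le _) hint (hlim h)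
  refine ⟨⟨fun h => ?_, hback⟩, fun h =>
    tendsto_nhds_unique (tendsto_setIntegral_Ioc_nhdsGT_zero (hback h)) (hlim h)⟩
  have := (((tendsto_const_nhds (x := v ^ γ * f v)).sub h0).sub
    (tendsto_setIntegral_Ioc_nhdsGT_zero h)).div_const γ
  refine integrableOn_Ioc_zero_of_tendsto
    (fun s hs => mul_nonneg (Real.rpow_nonneg hs.1.le _) (hpos s hs).le)
    (fun x hx => integrableOn_rpow_mul_Ioc _ hx hf) (this.congr' (hparts.mono fun x hx => ?_))
  rw [hx]
  field_simp
  ring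
/-- Potter's bound for monotone regularly varying functions. -/
theorem RegularlyVaryingAtZero.exists_potter_bound {f : ℝ → ℝ} {a α δ : ℝ} (ha : 0 < a)
    (hf : MonotoneOn f (Ioc 0 a)) (hpos : ∀ x ∈ Ioc 0 a, 0 < f x)
    (h : RegularlyVaryingAtZero f α) (hδ : δ < α) :
    ∃ x₀ ∈ Ioc 0 a, ∀ x ∈ Ioc 0 x₀, ∀ u ∈ Ioc (0 : ℝ) 1,
      f (u * x) ≤ 2 ^ |δ| * u ^ δ * f x := by
  have hlt : (1 / 2 : ℝ) ^ α < (1 / 2 : ℝ) ^ δ :=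
    Real.rpow_lt_rpow_of_exponent_gt (by norm_num) (by norm_num) hδ
  have hev := ((h (1 / 2) (by norm_num)).eventually_lt_const hlt)
  obtain ⟨b, hb, hbs⟩ := mem_nhdsGT_iff_exists_Ioc_subset.1 hev
  have hb0 : 0 < b := hb
  have hmin : 0 < min a b := lt_min ha hb0
  refine ⟨min a b, ⟨hmin, min_le_left _ _⟩, fun x hx u hu => ?_⟩
  have hxa : x ≤ a := hx.2.trans (min_le_left _ _)
  have hmem : ∀ n : ℕ, (1 / 2 : ℝ) ^ n * x ∈ Ioc 0 x := fun n =>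
    ⟨mul_pos (by positivity) hx.1,
      mul_le_of_le_one_left hx.1.le (pow_le_one₀ (by norm_num) (by norm_num))⟩
  have hpow : ∀ n : ℕ, f ((1 / 2 : ℝ) ^ n * x) ≤ ((1 / 2 : ℝ) ^ n) ^ δ * f x := fun n => by
    induction n with
    | zero => simp
    | succ n ih =>
      have hm := hmem n
      have hlt' : f (1 / 2 * ((1 / 2) ^ n * x)) / f ((1 / 2) ^ n * x) < (1 / 2) ^ δ :=
        hbs ⟨hm.1, hm.2.trans (hx.2.trans (min_le_right _ _))⟩
      rw [div_lt_iff₀ (hpos _ ⟨hm.1, hm.2.trans hxa⟩)] at hlt'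
      calc f ((1 / 2 : ℝ) ^ (n + 1) * x) = f (1 / 2 * ((1 / 2) ^ n * x)) := by
            rw [pow_succ']; ring_nf
        _ ≤ (1 / 2) ^ δ * f ((1 / 2) ^ n * x) := hlt'.le
        _ ≤ (1 / 2) ^ δ * (((1 / 2 : ℝ) ^ n) ^ δ * f x) := by gcongr
        _ = ((1 / 2 : ℝ) ^ (n + 1)) ^ δ * f x := by
            rw [pow_succ', Real.mul_rpow (by norm_num) (by positivity), mul_assoc]
  obtain ⟨n, hn₁, hn₂⟩ := exists_nat_pow_near_of_lt_one hu.1 hu.2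
    (by norm_num : (0 : ℝ) < 1 / 2) (by norm_num)
  have hfx : 0 < f x := hpos x ⟨hx.1, hxa⟩
  have hratio : ((1 / 2 : ℝ) ^ n) ^ δ ≤ 2 ^ |δ| * u ^ δ := by
    have h1 : 1 ≤ (1 / 2 : ℝ) ^ n / u := (one_le_div hu.1).2 hn₂
    have h2 : (1 / 2 : ℝ) ^ n / u ≤ 2 := by
      rw [div_le_iff₀ hu.1]
      rw [pow_succ] at hn₁
      linarith
    calc ((1 / 2 : ℝ) ^ n) ^ δ = ((1 / 2 : ℝ) ^ n / u) ^ δ * u ^ δ := by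
          rw [← Real.mul_rpow (by positivity) hu.1.le, div_mul_cancel₀ _ hu.1.ne']
      _ ≤ ((1 / 2 : ℝ) ^ n / u) ^ |δ| * u ^ δ := by
          gcongr
          · exact Real.rpow_nonneg hu.1.le _
          · exact le_abs_self δ
      _ ≤ 2 ^ |δ| * u ^ δ := by
          have := Real.rpow_nonneg hu.1.le δ
          gcongr
  have hux : u * x ≤ (1 / 2 : ℝ) ^ n * x := by
    have := hx.1
    gcongr
  calc f (u * x) ≤ f ((1 / 2 : ℝ) ^ n * x) :=
        hf ⟨mul_pos hu.1 hx.1, hux.trans ((hmem n).2.trans hxa)⟩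
          ⟨(hmem n).1, (hmem n).2.trans hxa⟩ hux
    _ ≤ ((1 / 2 : ℝ) ^ n) ^ δ * f x := hpow n
    _ ≤ 2 ^ |δ| * u ^ δ * f x := by gcongr

theorem RegularlyVaryingAtZero.tendsto_rpow_mul {f : ℝ → ℝ} {a α γ : ℝ} (ha : 0 < a)
    (hf : MonotoneOn f (Ioc 0 a)) (hpos : ∀ x ∈ Ioc 0 a, 0 < f x)
    (h : RegularlyVaryingAtZero f α) (hγα : 0 < γ + α) :
    Tendsto (fun v => v ^ γ * f v) (𝓝[>] 0) (𝓝 0) := by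
  obtain ⟨x₀, hx₀, hb⟩ := h.exists_potter_bound (δ := α - (γ + α) / 2) ha hf hpos (by linarith)
  set δ := α - (γ + α) / 2 with hδ
  have hγδ : 0 < γ + δ := by rw [hδ]; linarith
  have hlim : Tendsto (fun v : ℝ => v ^ (γ + δ) * (2 ^ |δ| * (x₀ ^ δ)⁻¹ * f x₀))
      (𝓝[>] 0) (𝓝 0) := by
    have := ((Real.continuousAt_rpow_const 0 (γ + δ) (Or.inr hγδ.le)).tendsto.mono_left
      (nhdsWithin_le_nhds (s := Ioi 0))).mul_const (2 ^ |δ| * (x₀ ^ δ)⁻¹ * f x₀)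
    rwa [Real.zero_rpow hγδ.ne', zero_mul] at this
  refine tendsto_of_tendsto_of_tendsto_of_le_of_le' tendsto_const_nhds hlim ?_ ?_
  · filter_upwards [Ioo_mem_nhdsGT ha] with v hv
    exact mul_nonneg (Real.rpow_nonneg hv.1.le _) (hpos v (Ioo_subset_Ioc_self hv)).le
  · filter_upwards [Ioo_mem_nhdsGT hx₀.1] with v hv
    have := hb x₀ ⟨hx₀.1, le_rfl⟩ (v / x₀)
      ⟨div_pos hv.1 hx₀.1, (div_le_one hx₀.1).2 hv.2.le⟩
    rw [div_mul_cancel₀ _ hx₀.1.ne', Real.div_rpow hv.1.le hx₀.1.le] at this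
    calc v ^ γ * f v ≤ v ^ γ * (2 ^ |δ| * (v ^ δ / x₀ ^ δ) * f x₀) := by
          have := Real.rpow_nonneg hv.1.le γ
          gcongr
      _ = v ^ (γ + δ) * (2 ^ |δ| * (x₀ ^ δ)⁻¹ * f x₀) := by
          rw [Real.rpow_add hv.1]; ring

theorem setIntegral_rpow_mul_eq_rescale {f : ℝ → ℝ} {v γ : ℝ} (hv : 0 < v) :
    ∫ s in Ioc 0 v, s ^ (γ - 1) * f s =
      v ^ γ * ∫ u in Ioc 0 1, u ^ (γ - 1) * f (u * v) := by
  have := intervalIntegral.mul_integral_comp_mul_right (a := 0) (b := 1)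
    (f := fun s => s ^ (γ - 1) * f s) v
  rw [zero_mul, one_mul, intervalIntegral.integral_of_le hv.le,
    intervalIntegral.integral_of_le zero_le_one] at this
  rw [← this, ← integral_const_mul, ← integral_const_mul]
  refine setIntegral_congr_fun measurableSet_Ioc fun u hu => ?_
  rw [Real.mul_rpow hu.1.le hv.le, Real.rpow_sub_one hv.ne']
  field_simp

/-- Karamata's theorem, direct half. -/
theorem RegularlyVaryingAtZero.tendsto_setIntegral_div {f : ℝ → ℝ} {a α γ : ℝ} (ha : 0 < a)
    (hf : MonotoneOn f (Ioc 0 a)) (hpos : ∀ x ∈ Ioc 0 a, 0 < f x)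
    (h : RegularlyVaryingAtZero f α) (hγα : 0 < γ + α) :
    IntegrableOn (fun s => s ^ (γ - 1) * f s) (Ioc 0 a) ∧
    Tendsto (fun v => (∫ s in Ioc 0 v, s ^ (γ - 1) * f s) / (v ^ γ * f v))
      (𝓝[>] 0) (𝓝 (1 / (γ + α))) := by
  obtain ⟨x₀, hx₀, hb⟩ := h.exists_potter_bound (δ := α - (γ + α) / 2) ha hf hpos (by linarith)
  set δ := α - (γ + α) / 2 with hδ
  have hγδ : 0 < γ + δ := by rw [hδ]; linarith
  have hrpow : ∀ r : ℝ, -1 < r → ∀ b : ℝ, 0 ≤ b → IntegrableOn (fun s : ℝ => s ^ r) (Ioc 0 b) :=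
    fun r hr b hb => (intervalIntegrable_iff_integrableOn_Ioc_of_le hb).1
      (intervalIntegral.intervalIntegrable_rpow' hr)
  constructor
  · rw [← Ioc_union_Ioc_eq_Ioc hx₀.1.le hx₀.2]
    refine IntegrableOn.union ?_ (integrableOn_rpow_mul_Ioc _ hx₀.1 hf)
    refine ((hrpow (γ - 1 + δ) (by linarith) x₀ hx₀.1.le).mul_const
      (2 ^ |δ| * (x₀ ^ δ)⁻¹ * f x₀)).mono' ?_ ?_
    · exact ((by fun_prop : Measurable fun s : ℝ => s ^ (γ - 1)).aemeasurable.mul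
        (aemeasurable_restrict_of_monotoneOn measurableSet_Ioc
          (hf.mono (Ioc_subset_Ioc_right hx₀.2)))).aestronglyMeasurable
    · refine (ae_restrict_mem measurableSet_Ioc).mono fun v hv => ?_
      have hn := mul_nonneg (Real.rpow_nonneg hv.1.le (γ - 1)) (hpos v ⟨hv.1, hv.2.trans hx₀.2⟩).le
      rw [Real.norm_of_nonneg hn]
      have := hb x₀ ⟨hx₀.1, le_rfl⟩ (v / x₀)
        ⟨div_pos hv.1 hx₀.1, (div_le_one hx₀.1).2 hv.2⟩
      rw [div_mul_cancel₀ _ hx₀.1.ne', Real.div_rpow hv.1.le hx₀.1.le] at this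
      calc v ^ (γ - 1) * f v ≤ v ^ (γ - 1) * (2 ^ |δ| * (v ^ δ / x₀ ^ δ) * f x₀) := by
            have := Real.rpow_nonneg hv.1.le (γ - 1)
            gcongr
        _ = v ^ (γ - 1 + δ) * (2 ^ |δ| * (x₀ ^ δ)⁻¹ * f x₀) := by
            rw [Real.rpow_add hv.1]; ring
  · have hval : ∫ u in Ioc (0 : ℝ) 1, u ^ (γ - 1) * u ^ α = 1 / (γ + α) := by
      rw [setIntegral_congr_fun (g := fun u => u ^ (γ - 1 + α)) measurableSet_Ioc
        fun u hu => (Real.rpow_add hu.1 _ _).symm, ← intervalIntegral.integral_of_le zero_le_one,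
        integral_rpow (Or.inl (by linarith)), Real.one_rpow,
        Real.zero_rpow (by linarith), sub_zero]
      ring_nf
    rw [← hval]
    have hdct : Tendsto (fun v => ∫ u in Ioc (0 : ℝ) 1, u ^ (γ - 1) * (f (u * v) / f v))
        (𝓝[>] 0) (𝓝 (∫ u in Ioc (0 : ℝ) 1, u ^ (γ - 1) * u ^ α)) := by
      refine tendsto_integral_filter_of_dominated_convergence
        (fun u => u ^ (γ - 1 + δ) * 2 ^ |δ|) ?_ ?_
        ((hrpow (γ - 1 + δ) (by linarith) 1 zero_le_one).mul_const _) ?_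
      · filter_upwards [Ioo_mem_nhdsGT ha] with v hv
        have hmon : MonotoneOn (fun u => f (u * v)) (Ioc 0 1) := fun s hs t ht hst =>
          hf ⟨mul_pos hs.1 hv.1, (mul_le_of_le_one_left hv.1.le hs.2).trans hv.2.le⟩
            ⟨mul_pos ht.1 hv.1, (mul_le_of_le_one_left hv.1.le ht.2).trans hv.2.le⟩
            (mul_le_mul_of_nonneg_right hst hv.1.le)
        exact ((by fun_prop : Measurable fun s : ℝ => s ^ (γ - 1)).aemeasurable.mul
          ((aemeasurable_restrict_of_monotoneOn measurableSet_Ioc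
            hmon).div_const _)).aestronglyMeasurable
      · filter_upwards [Ioo_mem_nhdsGT hx₀.1] with v hv
        refine (ae_restrict_mem measurableSet_Ioc).mono fun u hu => ?_
        have hfv := hpos v ⟨hv.1, hv.2.le.trans hx₀.2⟩
        have hfuv := hpos (u * v) ⟨mul_pos hu.1 hv.1,
          (mul_le_of_le_one_left hv.1.le hu.2).trans (hv.2.le.trans hx₀.2)⟩
        have hu0 := Real.rpow_nonneg hu.1.le (γ - 1)
        rw [Real.norm_of_nonneg (by positivity), Real.rpow_add hu.1, mul_assoc]
        gcongr
        rw [div_le_iff₀ hfv, mul_comm (u ^ δ)]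
        exact hb v (Ioo_subset_Ioc_self hv) u hu
      · exact (ae_restrict_mem measurableSet_Ioc).mono fun u hu => (h u hu.1).const_mul _
    refine hdct.congr' ?_
    filter_upwards [Ioo_mem_nhdsGT ha] with v hv
    rw [setIntegral_rpow_mul_eq_rescale hv.1, mul_div_mul_left _ _ (Real.rpow_pos_of_pos hv.1 _).ne',
      ← integral_div]
    simp only [mul_div_assoc]

theorem tendsto_const_mul_nhdsGT_zero {c : ℝ} (hc : 0 < c) :
    Tendsto (fun x => c * x) (𝓝[>] 0) (𝓝[>] 0) := by
  refine tendsto_nhdsWithin_iff.2 ⟨?_, ?_⟩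
  · have : Tendsto (fun x : ℝ => c * x) (𝓝 0) (𝓝 (c * 0)) := (continuous_const_mul c).tendsto 0
    rw [mul_zero] at this
    exact this.mono_left nhdsWithin_le_nhds
  · filter_upwards [self_mem_nhdsWithin] with x hx using mul_pos hc hx

/-- A function whose right logarithmic derivative `x * L' x` tends to `β` at `0₊` satisfies
`L (l * x) - L x → β * log l`. -/
theorem tendsto_sub_of_tendsto_mul_derivWithin {L L' : ℝ → ℝ} {a β : ℝ} (ha : 0 < a)
    (hL : ContinuousOn L (Ioo 0 a)) (hL' : ∀ x ∈ Ioo 0 a, HasDerivWithinAt L (L' x) (Ici x) x)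
    (hlim : Tendsto (fun x => x * L' x) (𝓝[>] 0) (𝓝 β)) {l : ℝ} (hl : 0 < l) :
    Tendsto (fun x => L (l * x) - L x) (𝓝[>] 0) (𝓝 (β * Real.log l)) := by
  have key : ∀ l : ℝ, 1 ≤ l →
      Tendsto (fun x => L (l * x) - L x) (𝓝[>] 0) (𝓝 (β * Real.log l)) := fun l hl => by
    have hl0 : 0 < l := one_pos.trans_le hl
    rw [Metric.tendsto_nhds]
    intro ε hε
    have hη : 0 < ε / l := div_pos hε hl0
    obtain ⟨b, hb, hbs⟩ := mem_nhdsGT_iff_exists_Ioc_subset.1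
      (Metric.tendsto_nhds.1 hlim (ε / l) hη)
    have hb0 : 0 < b := hb
    filter_upwards [Ioo_mem_nhdsGT (div_pos (lt_min ha hb0) hl0)] with x hx
    have hlx : l * x < min a b := by rw [mul_comm]; exact (lt_div_iff₀ hl0).1 hx.2
    have hxl : x ≤ l * x := le_mul_of_one_le_left hx.1.le hl
    have hpos : ∀ y ∈ Icc x (l * x), 0 < y := fun y hy => hx.1.trans_le hy.1
    have hbound := norm_image_sub_le_of_norm_deriv_right_le_segment
      (f := fun y => L y - β * Real.log y) (f' := fun y => L' y - β * y⁻¹)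
      (a := x) (b := l * x) (C := ε / l / x) ?_ ?_ ?_ (l * x) ⟨hxl, le_rfl⟩
    · have hlog : Real.log (l * x) = Real.log l + Real.log x := Real.log_mul hl0.ne' hx.1.ne'
      simp only [hlog] at hbound
      rw [Real.dist_eq, ← Real.norm_eq_abs]
      have hx0 := hx.1
      calc ‖L (l * x) - L x - β * Real.log l‖
          = ‖L (l * x) - β * (Real.log l + Real.log x) - (L x - β * Real.log x)‖ := by ring_nf
        _ ≤ ε / l / x * (l * x - x) := hbound
        _ = ε - ε / l := by field_simp
        _ < ε := by linarith
    · refine (hL.mono fun y hy => ⟨hpos y hy, hy.2.trans_lt (hlx.trans_le (min_le_left _ _))⟩).sub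
        (continuousOn_const.mul (Real.continuousOn_log.mono fun y hy => (hpos y hy).ne'))
    · exact fun y hy => (hL' y ⟨hx.1.trans_le hy.1, hy.2.trans (hlx.trans_le (min_le_left _ _))⟩).sub
        ((Real.hasDerivAt_log (hx.1.trans_le hy.1).ne').hasDerivWithinAt.const_mul β)
    · intro y hy
      have hy0 : 0 < y := hx.1.trans_le hy.1
      have hd : dist (y * L' y) β < ε / l :=
        hbs ⟨hy0, (hy.2.trans (hlx.trans_le (min_le_right _ _))).le⟩
      rw [Real.dist_eq, ← Real.norm_eq_abs] at hd
      have hx0 := hx.1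
      calc ‖L' y - β * y⁻¹‖ = ‖y * L' y - β‖ / y := by
            rw [← Real.norm_of_nonneg hy0.le, ← norm_div, Real.norm_of_nonneg hy0.le]
            congr 1
            field_simp
        _ ≤ ε / l / x := by gcongr; exact hy.1
  rcases le_or_gt 1 l with h1 | h1
  · exact key l h1
  · have := ((key l⁻¹ ((one_le_inv₀ hl).2 h1.le)).comp (tendsto_const_mul_nhdsGT_zero hl)).neg
    rw [Real.log_inv, mul_neg, neg_neg] at this
    refine this.congr fun x => ?_
    simp only [Function.comp, inv_mul_cancel_left₀ hl.ne']
    ring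

/-- Karamata's theorem, converse half. -/
theorem regularlyVaryingAtZero_of_tendsto_setIntegral_div {f : ℝ → ℝ} {a α γ : ℝ} (ha : 0 < a)
    (hpos : ∀ x ∈ Ioc 0 a, 0 < f x)
    (hrc : ∀ x ∈ Ioo 0 a, Tendsto f (𝓝[>] x) (𝓝 (f x))) (hγα : 0 < γ + α)
    (hint : IntegrableOn (fun s => s ^ (γ - 1) * f s) (Ioc 0 a))
    (hlim : Tendsto (fun v => (∫ s in Ioc 0 v, s ^ (γ - 1) * f s) / (v ^ γ * f v))
      (𝓝[>] 0) (𝓝 (1 / (γ + α)))) :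
    RegularlyVaryingAtZero f α := by
  set F : ℝ → ℝ := fun v => ∫ s in (0 : ℝ)..v, s ^ (γ - 1) * f s with hF
  have hii : ∀ v ∈ Ioc 0 a, IntervalIntegrable (fun s => s ^ (γ - 1) * f s) volume 0 v :=
    fun v hv => (intervalIntegrable_iff_integrableOn_Ioc_of_le hv.1.le).2
      (hint.mono_set (Ioc_subset_Ioc_right hv.2))
  have hFpos : ∀ v ∈ Ioc 0 a, 0 < F v := fun v hv =>
    intervalIntegral.intervalIntegral_pos_of_pos_on (hii v hv)
      (fun s hs => mul_pos (Real.rpow_pos_of_pos hs.1 _) (hpos s ⟨hs.1, hs.2.le.trans hv.2⟩)) hv.1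
  have hFlim : Tendsto (fun v => F v / (v ^ γ * f v)) (𝓝[>] 0) (𝓝 (1 / (γ + α))) := by
    refine hlim.congr' ?_
    filter_upwards [self_mem_nhdsWithin] with v hv
    simp only [hF, intervalIntegral.integral_of_le (le_of_lt hv)]
  have hFcont : ContinuousOn F (Icc 0 a) := by
    have := intervalIntegral.continuousOn_primitive_interval (μ := volume) (a := 0) (b := a)
      (f := fun s => s ^ (γ - 1) * f s)
      (by rw [uIcc_of_le ha.le]; exact (integrableOn_Icc_iff_integrableOn_Ioc).2 hint)
    rwa [uIcc_of_le ha.le] at this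
  have hFderiv : ∀ x ∈ Ioo 0 a, HasDerivWithinAt F (x ^ (γ - 1) * f x) (Ici x) x := fun x hx => by
    refine intervalIntegral.integral_hasDerivWithinAt_right (t := Ioi x)
      (hii x (Ioo_subset_Ioc_self hx)) ?_ ?_
    · exact ⟨Ioc 0 a, mem_nhdsWithin_of_mem_nhds (Ioc_mem_nhds hx.1 hx.2),
        hint.aestronglyMeasurable⟩
    · exact (Real.continuousAt_rpow_const x _ (Or.inl hx.1.ne')).continuousWithinAt.mul (hrc x hx)
  have hlog := fun l (hl : 0 < l) => tendsto_sub_of_tendsto_mul_derivWithin (β := γ + α)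
    (L := fun x => Real.log (F x)) (L' := fun x => x ^ (γ - 1) * f x / F x) ha
    ((hFcont.mono Ioo_subset_Icc_self).log fun x hx => (hFpos x (Ioo_subset_Ioc_self hx)).ne')
    (fun x hx => (hFderiv x hx).log (hFpos x (Ioo_subset_Ioc_self hx)).ne') (by
      have := hFlim.inv₀ (by positivity)
      rw [one_div, inv_inv] at this
      refine this.congr' ?_
      filter_upwards [self_mem_nhdsWithin] with x hx
      have hx : 0 < x := hx
      rw [inv_div, Real.rpow_sub_one hx.ne']
      field_simp) hl
  intro l hl
  have hexp := (Real.continuous_exp.tendsto _).comp (hlog l hl)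
  have hmain := (hexp.mul (hFlim.div (hFlim.comp (tendsto_const_mul_nhdsGT_zero hl))
    (by positivity))).mul_const (l ^ (-γ))
  have hval : Real.exp ((γ + α) * Real.log l) * (1 / (γ + α) / (1 / (γ + α))) * l ^ (-γ) =
      l ^ α := by
    rw [div_self (by positivity), mul_one, mul_comm (γ + α), ← Real.rpow_def_of_pos hl,
      ← Real.rpow_add hl]
    ring_nf
  rw [hval] at hmain
  refine hmain.congr' ?_
  filter_upwards [Ioo_mem_nhdsGT (div_pos ha hl), Ioo_mem_nhdsGT ha] with x hx hxa
  have hlx : l * x ∈ Ioc 0 a := ⟨mul_pos hl hx.1, by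
    rw [mul_comm]; exact ((lt_div_iff₀ hl).1 hx.2).le⟩
  have hx' := Ioo_subset_Ioc_self hxa
  have h1 := hFpos _ hlx
  have h2 := hFpos _ hx'
  have h3 := hpos _ hlx
  have h4 := hpos _ hx'
  have h5 := Real.rpow_pos_of_pos hl γ
  have h6 := Real.rpow_pos_of_pos hx.1 γ
  simp only [Function.comp, Pi.div_apply]
  rw [Real.exp_sub, Real.exp_log h1, Real.exp_log h2, Real.mul_rpow hl.le hx.1.le,
    Real.rpow_neg hl.le]
  field_simp

end

/-- **Theorem A.7.** Let `f : (0,a] → (0,∞)` be nondecreasing and right-continuous with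
Lebesgue–Stieltjes measure `μ` (characterized by `μ((x,y]) = f(y) - f(x)`). Then `f` is
regularly varying at `0₊` with index `α` iff for every (equivalently, some) `γ ≠ 0` with
`γ + α > 0` the conditions (A.7) `∫_{(0,a]} s^γ dμ(s) < ∞`, (A.8) `v^γ f(v) → 0` as `v ↓ 0`
and (A.9) `lim_{v↓0} (v^γ f(v))⁻¹ ∫_{(0,v]} s^γ dμ(s) = α/(γ+α)` hold. -/
theorem stmt_11 (a α : ℝ) (ha : 0 < a) (f : ℝ → ℝ)
    (hmono : ∀ x y, 0 < x → x ≤ y → y ≤ a → f x ≤ f y)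
    (hpos : ∀ x ∈ Set.Ioc (0 : ℝ) a, 0 < f x)
    (hrc : ∀ x ∈ Set.Ioo (0 : ℝ) a, Tendsto f (nhdsWithin x (Set.Ioi x)) (nhds (f x)))
    (μ : Measure ℝ)
    (hμ : ∀ x y, 0 < x → x ≤ y → y ≤ a → μ (Set.Ioc x y) = ENNReal.ofReal (f y - f x)) :
    (RegularlyVaryingAtZero f α ↔
      ∀ γ : ℝ, γ ≠ 0 → 0 < γ + α →
        (∫⁻ s in Set.Ioc (0 : ℝ) a, ENNReal.ofReal (s ^ γ) ∂μ) < ⊤ ∧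
        Tendsto (fun v => v ^ γ * f v) (nhdsWithin 0 (Set.Ioi 0)) (nhds 0) ∧
        Tendsto (fun v => (1 / (v ^ γ * f v)) * ∫ s in Set.Ioc (0 : ℝ) v, s ^ γ ∂μ)
          (nhdsWithin 0 (Set.Ioi 0)) (nhds (α / (γ + α)))) ∧
    (RegularlyVaryingAtZero f α ↔
      ∃ γ : ℝ, γ ≠ 0 ∧ 0 < γ + α ∧
        (∫⁻ s in Set.Ioc (0 : ℝ) a, ENNReal.ofReal (s ^ γ) ∂μ) < ⊤ ∧
        Tendsto (fun v => v ^ γ * f v) (nhdsWithin 0 (Set.Ioi 0)) (nhds 0) ∧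
        Tendsto (fun v => (1 / (v ^ γ * f v)) * ∫ s in Set.Ioc (0 : ℝ) v, s ^ γ ∂μ)
          (nhdsWithin 0 (Set.Ioi 0)) (nhds (α / (γ + α)))) := by
  have hf : MonotoneOn f (Set.Ioc 0 a) := fun x hx y hy hxy => hmono x y hx.1 hxy hy.2
  have hparts := fun (γ : ℝ) (hγ : γ ≠ 0) v (hv : v ∈ Set.Ioc 0 a) =>
    integrableOn_rpow_stieltjes_iff (γ := γ) hv.1 hγ (hf.mono (Set.Ioc_subset_Ioc_right hv.2))
      (fun x hx => hpos x ⟨hx.1, hx.2.trans hv.2⟩)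
      (fun x y hx hxy hyv => hμ x y hx hxy (hyv.trans hv.2))
  have hfinite : ∀ γ : ℝ, (∫⁻ s in Set.Ioc (0 : ℝ) a, ENNReal.ofReal (s ^ γ) ∂μ) < ⊤ ↔
      IntegrableOn (fun s => s ^ γ) (Set.Ioc 0 a) μ := fun γ => by
    rw [lt_top_iff_ne_top, lintegral_ofReal_ne_top_iff_integrable (by fun_prop)
      ((ae_restrict_mem measurableSet_Ioc).mono fun s hs => Real.rpow_nonneg hs.1.le γ),
      IntegrableOn]
  -- integration by parts makes this quotient an affine function of the Karamata quotient
  have hquot : ∀ γ : ℝ, γ ≠ 0 →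
      Tendsto (fun v => v ^ γ * f v) (nhdsWithin 0 (Set.Ioi 0)) (nhds 0) →
      IntegrableOn (fun s => s ^ (γ - 1) * f s) (Set.Ioc 0 a) →
      ∀ᶠ v in nhdsWithin 0 (Set.Ioi 0),
        (1 / (v ^ γ * f v)) * ∫ s in Set.Ioc (0 : ℝ) v, s ^ γ ∂μ =
          1 - γ * ((∫ s in Set.Ioc 0 v, s ^ (γ - 1) * f s) / (v ^ γ * f v)) := by
    intro γ hγ h0 hint
    filter_upwards [Ioo_mem_nhdsGT ha] with v hv
    have hv' := Set.Ioo_subset_Ioc_self hv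
    have h1 := hpos v hv'
    have h2 := Real.rpow_pos_of_pos hv.1 γ
    rw [(hparts γ hγ v hv' h0).2 (hint.mono_set (Set.Ioc_subset_Ioc_right hv'.2))]
    field_simp
  have hdirect : RegularlyVaryingAtZero f α → ∀ γ : ℝ, γ ≠ 0 → 0 < γ + α →
      (∫⁻ s in Set.Ioc (0 : ℝ) a, ENNReal.ofReal (s ^ γ) ∂μ) < ⊤ ∧
      Tendsto (fun v => v ^ γ * f v) (nhdsWithin 0 (Set.Ioi 0)) (nhds 0) ∧
      Tendsto (fun v => (1 / (v ^ γ * f v)) * ∫ s in Set.Ioc (0 : ℝ) v, s ^ γ ∂μ)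
        (nhdsWithin 0 (Set.Ioi 0)) (nhds (α / (γ + α))) := by
    intro h γ hγ hγα
    have h0 := h.tendsto_rpow_mul ha hf hpos hγα
    obtain ⟨hint, hlim⟩ := h.tendsto_setIntegral_div ha hf hpos hγα
    refine ⟨(hfinite γ).2 ((hparts γ hγ a ⟨ha, le_rfl⟩ h0).1.2 hint), h0, ?_⟩
    have := (hlim.const_mul γ).const_sub 1
    rw [show 1 - γ * (1 / (γ + α)) = α / (γ + α) by field_simp; ring] at this
    exact this.congr' ((hquot γ hγ h0 hint).mono fun v hv => hv.symm)
  have hconverse : ∀ γ : ℝ, γ ≠ 0 → 0 < γ + α →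
      (∫⁻ s in Set.Ioc (0 : ℝ) a, ENNReal.ofReal (s ^ γ) ∂μ) < ⊤ →
      Tendsto (fun v => v ^ γ * f v) (nhdsWithin 0 (Set.Ioi 0)) (nhds 0) →
      Tendsto (fun v => (1 / (v ^ γ * f v)) * ∫ s in Set.Ioc (0 : ℝ) v, s ^ γ ∂μ)
        (nhdsWithin 0 (Set.Ioi 0)) (nhds (α / (γ + α))) → RegularlyVaryingAtZero f α := by
    intro γ hγ hγα hfin h0 hlim
    have hint := (hparts γ hγ a ⟨ha, le_rfl⟩ h0).1.1 ((hfinite γ).1 hfin)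
    refine regularlyVaryingAtZero_of_tendsto_setIntegral_div ha hpos hrc hγα hint ?_
    have := (hlim.const_sub 1).div_const γ
    rw [show (1 - α / (γ + α)) / γ = 1 / (γ + α) by field_simp; ring] at this
    refine this.congr' ((hquot γ hγ h0 hint).mono fun v hv => ?_)
    rw [hv]
    field_simp
    ring
  refine ⟨⟨hdirect, fun h => ?_⟩, ⟨fun h => ?_, ?_⟩⟩
  · obtain ⟨h7, h8, h9⟩ := h (|α| + 1) (by positivity) (by linarith [neg_abs_le α])
    exact hconverse _ (by positivity) (by linarith [neg_abs_le α]) h7 h8 h9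
  · have hγ : (|α| + 1) ≠ 0 := by positivity
    have hγα : 0 < |α| + 1 + α := by linarith [neg_abs_le α]
    exact ⟨_, hγ, hγα, hdirect h _ hγ hγα⟩
  · rintro ⟨γ, hγ, hγα, h7, h8, h9⟩
    exact hconverse γ hγ hγα h7 h8 h9
end

section
/- Let f and g be continuous strictly monotonic positive functions defined on (0,a] and let f be regularly varying at 0₊ with a nonzero index α. (a) If f and g are strictly increasing with lim_{x↓0} f(x) = lim_{x↓0} g(x) = 0, then the inverses f^{-1} and g^{-1} are increasing functions defined in a neighbourhood of 0₊ and: f ≈∼ g at 0₊ if and only if f^{-1} ≈∼ g^{-1} at 0₊. (b) If f and g are strictly decreasing and unbounded (lim_{x↓0} f(x) = lim_{x↓0} g(x) = +∞), then the inverses f^{-1} and g^{-1} are decreasing functions defined in a neighbourhood of +∞ and: f ≈∼ g at 0₊ if and only if f^{-1} ≈∼ g^{-1} at +∞. -/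
open Filter Set

/-- `f ≈∼ g` at `+∞` (Definition A.9): there is an increasing sequence `xₙ ≥ a` with
`xₙ → +∞` and `f(xₙ)/g(xₙ) → 1`. -/
def AsympEquivOnSeqAtTop (f g : ℝ → ℝ) (a : ℝ) : Prop :=
  ∃ x : ℕ → ℝ, StrictMono x ∧ (∀ n, a ≤ x n) ∧ Tendsto x atTop atTop ∧
    Tendsto (fun n => f (x n) / g (x n)) atTop (nhds 1)

/-- `F ≈∼ G` at `0₊` (Definition A.9): there is a decreasing sequence `yₙ ∈ (0,c]` with
`yₙ → 0` and `F(yₙ)/G(yₙ) → 1`. -/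
def AsympEquivOnSeqAtZero (F G : ℝ → ℝ) (c : ℝ) : Prop :=
  ∃ y : ℕ → ℝ, StrictAnti y ∧ (∀ n, y n ∈ Set.Ioc 0 c) ∧ Tendsto y atTop (nhds 0) ∧
    Tendsto (fun n => F (y n) / G (y n)) atTop (nhds 1)

theorem RegularlyVaryingAtZero.inv {f : ℝ → ℝ} {α : ℝ} (hf : RegularlyVaryingAtZero f α) :
    RegularlyVaryingAtZero (fun x => (f x)⁻¹) (-α) := by
  intro l hl
  rw [Real.rpow_neg hl.le]
  refine ((hf l hl).inv₀ (Real.rpow_pos_of_pos hl α).ne').congr fun x => ?_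
  rw [inv_div_inv, inv_div]

theorem RegularlyVaryingAtZero.index_nonneg {f : ℝ → ℝ} {a α : ℝ} (ha : 0 < a)
    (hpos : ∀ x ∈ Ioc (0 : ℝ) a, 0 < f x) (hmono : StrictMonoOn f (Ioc 0 a))
    (hf : RegularlyVaryingAtZero f α) : 0 ≤ α := by
  have h1 : (1 : ℝ) ≤ 2 ^ α := by
    refine ge_of_tendsto (hf 2 two_pos) ?_
    filter_upwards [Ioc_mem_nhdsGT (half_pos ha)] with x hx
    have hxa : x ∈ Ioc (0 : ℝ) a := ⟨hx.1, by linarith [hx.2]⟩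
    have hx2 : 2 * x ∈ Ioc (0 : ℝ) a := ⟨by linarith [hx.1], by linarith [hx.2]⟩
    rw [one_le_div (hpos x hxa)]
    exact (hmono hxa hx2 (by linarith [hx.1])).le
  by_contra! h
  exact absurd h1 (not_le.2 (Real.rpow_lt_one_of_one_lt_of_neg one_lt_two h))

/-- For a strictly increasing function that is regularly varying with nonzero index, asymptotic
equivalence of arguments is the same as asymptotic equivalence of values. -/
theorem RegularlyVaryingAtZero.tendsto_div_iff {f : ℝ → ℝ} {a α : ℝ} (ha : 0 < a) (hα : α ≠ 0)
    (hpos : ∀ x ∈ Ioc (0 : ℝ) a, 0 < f x) (hmono : StrictMonoOn f (Ioc 0 a))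
    (hf : RegularlyVaryingAtZero f α) {x y : ℕ → ℝ} (hx : ∀ n, x n ∈ Ioc 0 a)
    (hy : ∀ n, y n ∈ Ioc 0 a) (hy0 : Tendsto y atTop (nhds 0)) :
    Tendsto (fun n => x n / y n) atTop (nhds 1) ↔
      Tendsto (fun n => f (x n) / f (y n)) atTop (nhds 1) := by
  have hα0 : 0 < α := lt_of_le_of_ne (hf.index_nonneg ha hpos hmono) hα.symm
  have hscale : ∀ l : ℝ, 0 < l →
      Tendsto (fun n => f (l * y n) / f (y n)) atTop (nhds (l ^ α)) := fun l hl =>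
    (hf l hl).comp (tendsto_nhdsWithin_iff.2 ⟨hy0, .of_forall fun n => (hy n).1⟩)
  have hmem : ∀ l : ℝ, 0 < l → ∀ᶠ n in atTop, l * y n ∈ Ioc 0 a := by
    intro l hl
    have h : Tendsto (fun n => l * y n) atTop (nhds 0) := by simpa using hy0.const_mul l
    filter_upwards [h.eventually_lt_const ha] with n hn
    exact ⟨mul_pos hl (hy n).1, hn.le⟩
  have hcont : Tendsto (fun l : ℝ => l ^ α) (nhds 1) (nhds 1) := by
    simpa using (Real.continuousAt_rpow_const 1 α (Or.inl one_ne_zero)).tendsto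
  constructor
  · intro h
    refine tendsto_order.2 ⟨fun b hb => ?_, fun c hc => ?_⟩
    · obtain ⟨l, ⟨hbl, hl0⟩, hl1⟩ := ((((hcont.eventually_const_lt hb).and
        (eventually_gt_nhds one_pos)).filter_mono nhdsWithin_le_nhds).and
          (self_mem_nhdsWithin (s := Iio (1 : ℝ)))).exists
      filter_upwards [h.eventually_const_lt hl1, (hscale l hl0).eventually_const_lt hbl,
        hmem l hl0] with n h1 h2 h3
      rw [lt_div_iff₀ (hy n).1] at h1
      exact h2.trans (div_lt_div_of_pos_right (hmono h3 (hx n) h1) (hpos _ (hy n)))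
    · obtain ⟨l, hlc, hl1⟩ := (((hcont.eventually_lt_const hc).filter_mono
        nhdsWithin_le_nhds).and (self_mem_nhdsWithin (s := Ioi (1 : ℝ)))).exists
      have hl0 : 0 < l := one_pos.trans hl1
      filter_upwards [h.eventually_lt_const hl1, (hscale l hl0).eventually_lt_const hlc,
        hmem l hl0] with n h1 h2 h3
      rw [div_lt_iff₀ (hy n).1] at h1
      exact (div_lt_div_of_pos_right (hmono (hx n) h3 h1) (hpos _ (hy n))).trans h2
  · intro h
    refine tendsto_order.2 ⟨fun b hb => ?_, fun c hc => ?_⟩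
    · rcases le_or_gt b 0 with hb0 | hb0
      · exact .of_forall fun n => hb0.trans_lt (div_pos (hx n).1 (hy n).1)
      filter_upwards [(hscale b hb0).eventually_lt h (Real.rpow_lt_one hb0.le hb hα0),
        hmem b hb0] with n h1 h2
      rw [div_lt_div_iff_of_pos_right (hpos _ (hy n)), hmono.lt_iff_lt h2 (hx n)] at h1
      rwa [lt_div_iff₀ (hy n).1]
    · have hc0 : 0 < c := one_pos.trans hc
      filter_upwards [h.eventually_lt (hscale c hc0) (Real.one_lt_rpow hc hα0),
        hmem c hc0] with n h1 h2
      rw [div_lt_div_iff_of_pos_right (hpos _ (hy n)), hmono.lt_iff_lt (hx n) h2] at h1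
      rwa [div_lt_iff₀ (hy n).1]

theorem tendsto_div_one_comm {u v : ℕ → ℝ} :
    Tendsto (fun n => u n / v n) atTop (nhds 1) ↔
      Tendsto (fun n => v n / u n) atTop (nhds 1) := by
  constructor <;> intro h <;> simpa using h.inv₀ one_ne_zero

theorem RegularlyVaryingAtZero.asympEquivOnSeqAtZero_inverse_iff {f g finv ginv : ℝ → ℝ}
    {a α : ℝ} (ha : 0 < a) (hα : α ≠ 0)
    (hfpos : ∀ x ∈ Ioc (0 : ℝ) a, 0 < f x) (hgpos : ∀ x ∈ Ioc (0 : ℝ) a, 0 < g x)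
    (hf : RegularlyVaryingAtZero f α)
    (hfmono : StrictMonoOn f (Ioc 0 a)) (hgmono : StrictMonoOn g (Ioc 0 a))
    (hg0 : Tendsto g (nhdsWithin 0 (Ioi 0)) (nhds 0))
    (hfinv : ∀ y ∈ Ioc (0 : ℝ) (f a), finv y ∈ Ioc 0 a ∧ f (finv y) = y)
    (hginv_left : ∀ x ∈ Ioc (0 : ℝ) a, ginv (g x) = x)
    (hginv : ∀ y ∈ Ioc (0 : ℝ) (g a), ginv y ∈ Ioc 0 a ∧ g (ginv y) = y) :
    AsympEquivOnSeqAtZero f g a ↔ AsympEquivOnSeqAtZero finv ginv (min (f a) (g a)) := by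
  have haa : a ∈ Ioc 0 a := ⟨ha, le_rfl⟩
  constructor
  · rintro ⟨y, hanti, hy, hy0, hlim⟩
    have hgy : Tendsto (fun n => g (y n)) atTop (nhds 0) :=
      hg0.comp (tendsto_nhdsWithin_iff.2 ⟨hy0, .of_forall fun n => (hy n).1⟩)
    obtain ⟨N, hN⟩ := eventually_atTop.1
      (hgy.eventually_lt_const (lt_min (hfpos a haa) (hgpos a haa)))
    have hz : ∀ n, g (y (n + N)) ∈ Ioc 0 (min (f a) (g a)) := fun n =>
      ⟨hgpos _ (hy _), (hN _ (Nat.le_add_left N n)).le⟩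
    have hx : ∀ n, finv (g (y (n + N))) ∈ Ioc 0 a ∧
        f (finv (g (y (n + N)))) = g (y (n + N)) := fun n =>
      hfinv _ ⟨(hz n).1, (hz n).2.trans (min_le_left _ _)⟩
    refine ⟨fun n => g (y (n + N)), fun m n hmn => ?_, hz, (tendsto_add_atTop_iff_nat N).2 hgy, ?_⟩
    · exact hgmono (hy _) (hy _) (hanti (Nat.add_lt_add_right hmn N))
    · simp only [hginv_left _ (hy _)]
      rw [hf.tendsto_div_iff ha hα hfpos hfmono (fun n => (hx n).1) (fun n => hy (n + N))
        ((tendsto_add_atTop_iff_nat N).2 hy0)]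
      simp only [fun n => (hx n).2]
      exact (tendsto_add_atTop_iff_nat (f := fun n => g (y n) / f (y n)) N).2
        (tendsto_div_one_comm.1 hlim)
  · rintro ⟨z, hanti, hz, hz0, hlim⟩
    have hx : ∀ n, finv (z n) ∈ Ioc 0 a ∧ f (finv (z n)) = z n := fun n =>
      hfinv _ ⟨(hz n).1, (hz n).2.trans (min_le_left _ _)⟩
    have hy : ∀ n, ginv (z n) ∈ Ioc 0 a ∧ g (ginv (z n)) = z n := fun n =>
      hginv _ ⟨(hz n).1, (hz n).2.trans (min_le_right _ _)⟩
    have hy0 : Tendsto (fun n => ginv (z n)) atTop (nhds 0) := by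
      refine tendsto_order.2 ⟨fun b hb => .of_forall fun n => hb.trans (hy n).1.1, fun c hc => ?_⟩
      have hm : min c a ∈ Ioc 0 a := ⟨lt_min hc ha, min_le_right _ _⟩
      filter_upwards [hz0.eventually_lt_const (hgpos _ hm)] with n hn
      rw [← (hy n).2, hgmono.lt_iff_lt (hy n).1 hm] at hn
      exact hn.trans_le (min_le_left _ _)
    refine ⟨fun n => ginv (z n), fun m n hmn => ?_, fun n => (hy n).1, hy0, ?_⟩
    · rw [← hgmono.lt_iff_lt (hy n).1 (hy m).1, (hy n).2, (hy m).2]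
      exact hanti hmn
    · rw [hf.tendsto_div_iff ha hα hfpos hfmono (fun n => (hx n).1) (fun n => (hy n).1) hy0,
        tendsto_div_one_comm] at hlim
      simpa only [(hx _).2, (hy _).2] using hlim

theorem asympEquivOnSeqAtZero_inv_iff {f g : ℝ → ℝ} {a : ℝ} :
    AsympEquivOnSeqAtZero (fun x => (f x)⁻¹) (fun x => (g x)⁻¹) a ↔
      AsympEquivOnSeqAtZero f g a := by
  refine exists_congr fun y => and_congr_right' <| and_congr_right' <| and_congr_right' ?_
  simp only [inv_div_inv]
  exact tendsto_div_one_comm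

theorem asympEquivOnSeqAtZero_comp_inv_iff {F G : ℝ → ℝ} {c : ℝ} (hc : 0 < c) :
    AsympEquivOnSeqAtZero (fun y => F y⁻¹) (fun y => G y⁻¹) c⁻¹ ↔
      AsympEquivOnSeqAtTop F G c := by
  constructor
  · rintro ⟨y, hanti, hy, hy0, hlim⟩
    refine ⟨fun n => (y n)⁻¹, fun m n hmn => ?_, fun n => ?_, ?_, hlim⟩
    · exact inv_strictAnti₀ (hy n).1 (hanti hmn)
    · exact (le_inv_comm₀ hc (hy n).1).2 (hy n).2
    · exact tendsto_inv_nhdsGT_zero.comp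
        (tendsto_nhdsWithin_iff.2 ⟨hy0, .of_forall fun n => (hy n).1⟩)
  · rintro ⟨x, hmono, hx, hxtop, hlim⟩
    have hx0 : ∀ n, 0 < x n := fun n => hc.trans_le (hx n)
    refine ⟨fun n => (x n)⁻¹, fun m n hmn => ?_, fun n => ⟨inv_pos.2 (hx0 n), ?_⟩,
      tendsto_inv_atTop_zero.comp hxtop, by simpa only [inv_inv] using hlim⟩
    · exact inv_strictAnti₀ (hx0 m) (hmono hmn)
    · exact inv_anti₀ hc (hx n)

/-- **Corollary A.12.** Let `f, g : (0,a] → (0,∞)` be continuous and strictly monotonic and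
let `f` be regularly varying at `0₊` with a nonzero index `α`.
(a) If `f, g` are strictly increasing with limit `0` at `0₊`, then
`f ≈∼ g` at `0₊` iff `f⁻¹ ≈∼ g⁻¹` at `0₊`.
(b) If `f, g` are strictly decreasing and unbounded at `0₊`, then
`f ≈∼ g` at `0₊` iff `f⁻¹ ≈∼ g⁻¹` at `+∞`. -/
theorem stmt_16 (a α : ℝ) (ha : 0 < a) (hα : α ≠ 0) :
    (∀ f g finv ginv : ℝ → ℝ,
      ContinuousOn f (Ioc 0 a) → ContinuousOn g (Ioc 0 a) →
      (∀ x ∈ Ioc (0 : ℝ) a, 0 < f x) → (∀ x ∈ Ioc (0 : ℝ) a, 0 < g x) →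
      Measurable f → RegularlyVaryingAtZero f α →
      StrictMonoOn f (Ioc 0 a) → StrictMonoOn g (Ioc 0 a) →
      Tendsto f (nhdsWithin 0 (Ioi 0)) (nhds 0) →
      Tendsto g (nhdsWithin 0 (Ioi 0)) (nhds 0) →
      (∀ x ∈ Ioc (0 : ℝ) a, finv (f x) = x) →
      (∀ y ∈ Ioc (0 : ℝ) (f a), finv y ∈ Ioc 0 a ∧ f (finv y) = y) →
      (∀ x ∈ Ioc (0 : ℝ) a, ginv (g x) = x) →
      (∀ y ∈ Ioc (0 : ℝ) (g a), ginv y ∈ Ioc 0 a ∧ g (ginv y) = y) →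
      (AsympEquivOnSeqAtZero f g a ↔
        AsympEquivOnSeqAtZero finv ginv (min (f a) (g a)))) ∧
    (∀ f g finv ginv : ℝ → ℝ,
      ContinuousOn f (Ioc 0 a) → ContinuousOn g (Ioc 0 a) →
      (∀ x ∈ Ioc (0 : ℝ) a, 0 < f x) → (∀ x ∈ Ioc (0 : ℝ) a, 0 < g x) →
      Measurable f → RegularlyVaryingAtZero f α →
      StrictAntiOn f (Ioc 0 a) → StrictAntiOn g (Ioc 0 a) →
      Tendsto f (nhdsWithin 0 (Ioi 0)) atTop →
      Tendsto g (nhdsWithin 0 (Ioi 0)) atTop →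
      (∀ x ∈ Ioc (0 : ℝ) a, finv (f x) = x) →
      (∀ y, f a ≤ y → finv y ∈ Ioc 0 a ∧ f (finv y) = y) →
      (∀ x ∈ Ioc (0 : ℝ) a, ginv (g x) = x) →
      (∀ y, g a ≤ y → ginv y ∈ Ioc 0 a ∧ g (ginv y) = y) →
      (AsympEquivOnSeqAtZero f g a ↔
        AsympEquivOnSeqAtTop finv ginv (max (f a) (g a)))) := by
  refine ⟨?_, ?_⟩
  · intro f g finv ginv _ _ hfpos hgpos _ hf hfmono hgmono _ hg0 _ hfinv hginv_left hginv
    exact hf.asympEquivOnSeqAtZero_inverse_iff ha hα hfpos hgpos hfmono hgmono hg0 hfinv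
      hginv_left hginv
  · intro f g finv ginv _ _ hfpos hgpos _ hf hfanti hganti _ hg _ hfinv hginv_left hginv
    have haa : a ∈ Ioc 0 a := ⟨ha, le_rfl⟩
    have hfa := hfpos a haa
    have hga := hgpos a haa
    have hmin : min (f a)⁻¹ (g a)⁻¹ = (max (f a) (g a))⁻¹ := by
      rcases le_total (f a) (g a) with h | h
      · rw [max_eq_right h, min_eq_right (inv_anti₀ hfa h)]
      · rw [max_eq_left h, min_eq_left (inv_anti₀ hga h)]
    have key := hf.inv.asympEquivOnSeqAtZero_inverse_iff (g := fun x => (g x)⁻¹)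
      (finv := fun y => finv y⁻¹) (ginv := fun y => ginv y⁻¹) ha (neg_ne_zero.2 hα)
      (fun x hx => inv_pos.2 (hfpos x hx)) (fun x hx => inv_pos.2 (hgpos x hx))
      (fun x hx y hy hxy => inv_strictAnti₀ (hfpos y hy) (hfanti hx hy hxy))
      (fun x hx y hy hxy => inv_strictAnti₀ (hgpos y hy) (hganti hx hy hxy))
      (tendsto_inv_atTop_zero.comp hg)
      (fun y hy => by
        obtain ⟨h1, h2⟩ := hfinv y⁻¹ ((le_inv_comm₀ hfa hy.1).2 hy.2)
        exact ⟨h1, inv_eq_iff_eq_inv.2 h2⟩)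
      (fun x hx => by simpa only [inv_inv] using hginv_left x hx)
      (fun y hy => by
        obtain ⟨h1, h2⟩ := hginv y⁻¹ ((le_inv_comm₀ hga hy.1).2 hy.2)
        exact ⟨h1, inv_eq_iff_eq_inv.2 h2⟩)
    rwa [hmin, asympEquivOnSeqAtZero_inv_iff,
      asympEquivOnSeqAtZero_comp_inv_iff (lt_max_of_lt_left hfa)] at key
end
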